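/- Let w : ℝ³ → ℝ be a smooth solution of the PKP equation and let h : ℝ → ℝ be smooth. Define Q : ℝ³ → ℝ by Q = h(t)∂ₓ w + (2/3)x h'(t) + (4/9)y² h''(t). Then Q satisfies the linearized PKP equation at w; that is, the Kac–Moody flow X(h) is a symmetry of the PKP equation for every smooth h. -/

import Mathlib

noncomputable section

/-- Partial derivative in the first variable `x`. -/
def dx (w : ℝ → ℝ → ℝ → ℝ) : ℝ → ℝ → ℝ → ℝ :=
  fun x y t => deriv (fun s => w s y t) x

/-- Partial derivative in the second variable `y`. -/
def dy (w : ℝ → ℝ → ℝ → ℝ) : ℝ → ℝ → ℝ → ℝ :=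
  fun x y t => deriv (fun s => w x s t) y

/-- Partial derivative in the third variable `t`. -/
def dt (w : ℝ → ℝ → ℝ → ℝ) : ℝ → ℝ → ℝ → ℝ :=
  fun x y t => deriv (fun s => w x y s) t

/-- Smoothness of a function of three real variables. -/
def Smooth3 (w : ℝ → ℝ → ℝ → ℝ) : Prop :=
  ContDiff ℝ (⊤ : ℕ∞) (fun p : ℝ × ℝ × ℝ => w p.1 p.2.1 p.2.2)

/-- The potential Kadomtsev–Petviashvili equation. -/
def PKP (w : ℝ → ℝ → ℝ → ℝ) : Prop :=
  ∀ x y t, dx (dt w) x y t =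
      (1/4) * dx (dx (dx (dx w))) x y t
    + (3/2) * dx w x y t * dx (dx w) x y t
    + (3/4) * dy (dy w) x y t

/-- The linearization of the PKP equation at a solution `w`. -/
def LinPKP (w Q : ℝ → ℝ → ℝ → ℝ) : Prop :=
  ∀ x y t, dx (dt Q) x y t =
      (1/4) * dx (dx (dx (dx Q))) x y t
    + (3/2) * (dx Q x y t * dx (dx w) x y t + dx w x y t * dx (dx Q) x y t)
    + (3/4) * dy (dy Q) x y t

/-- A function of three variables, viewed as a function on the product. -/
def uncurry3 (w : ℝ → ℝ → ℝ → ℝ) : ℝ × ℝ × ℝ → ℝ := fun p => w p.1 p.2.1 p.2.2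

lemma Smooth3.hasFDerivAt {w : ℝ → ℝ → ℝ → ℝ} (hw : Smooth3 w) (p : ℝ × ℝ × ℝ) :
    HasFDerivAt (uncurry3 w) (fderiv ℝ (uncurry3 w) p) p :=
  (ContDiff.differentiable (f := uncurry3 w) hw (by simp) p).hasFDerivAt

lemma Smooth3.hasDerivAt_fst_fderiv {w : ℝ → ℝ → ℝ → ℝ} (hw : Smooth3 w) (x y t : ℝ) :
    HasDerivAt (fun s => w s y t) (fderiv ℝ (uncurry3 w) (x, y, t) (1, 0, 0)) x :=
  HasFDerivAt.comp_hasDerivAt (l := uncurry3 w) x (hw.hasFDerivAt (x, y, t))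
    ((hasDerivAt_id x).prodMk ((hasDerivAt_const x y).prodMk (hasDerivAt_const x t)))

lemma Smooth3.hasDerivAt_snd_fderiv {w : ℝ → ℝ → ℝ → ℝ} (hw : Smooth3 w) (x y t : ℝ) :
    HasDerivAt (fun s => w x s t) (fderiv ℝ (uncurry3 w) (x, y, t) (0, 1, 0)) y :=
  HasFDerivAt.comp_hasDerivAt (l := uncurry3 w) y (hw.hasFDerivAt (x, y, t))
    ((hasDerivAt_const y x).prodMk ((hasDerivAt_id y).prodMk (hasDerivAt_const y t)))

lemma Smooth3.hasDerivAt_thd_fderiv {w : ℝ → ℝ → ℝ → ℝ} (hw : Smooth3 w) (x y t : ℝ) :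
    HasDerivAt (fun s => w x y s) (fderiv ℝ (uncurry3 w) (x, y, t) (0, 0, 1)) t :=
  HasFDerivAt.comp_hasDerivAt (l := uncurry3 w) t (hw.hasFDerivAt (x, y, t))
    ((hasDerivAt_const t x).prodMk ((hasDerivAt_const t y).prodMk (hasDerivAt_id t)))

lemma Smooth3.uncurry3_dx {w : ℝ → ℝ → ℝ → ℝ} (hw : Smooth3 w) :
    uncurry3 (dx w) = fun p => fderiv ℝ (uncurry3 w) p (1, 0, 0) :=
  funext fun p => (hw.hasDerivAt_fst_fderiv p.1 p.2.1 p.2.2).deriv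

lemma Smooth3.uncurry3_dy {w : ℝ → ℝ → ℝ → ℝ} (hw : Smooth3 w) :
    uncurry3 (dy w) = fun p => fderiv ℝ (uncurry3 w) p (0, 1, 0) :=
  funext fun p => (hw.hasDerivAt_snd_fderiv p.1 p.2.1 p.2.2).deriv

lemma Smooth3.uncurry3_dt {w : ℝ → ℝ → ℝ → ℝ} (hw : Smooth3 w) :
    uncurry3 (dt w) = fun p => fderiv ℝ (uncurry3 w) p (0, 0, 1) :=
  funext fun p => (hw.hasDerivAt_thd_fderiv p.1 p.2.1 p.2.2).deriv

lemma Smooth3.contDiff_fderiv {w : ℝ → ℝ → ℝ → ℝ} (hw : Smooth3 w) :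
    ContDiff ℝ (⊤ : ℕ∞) (fderiv ℝ (uncurry3 w)) :=
  ContDiff.fderiv_right (f := uncurry3 w) hw (by simp)

lemma Smooth3.dx {w : ℝ → ℝ → ℝ → ℝ} (hw : Smooth3 w) : Smooth3 (dx w) := by
  change ContDiff ℝ (⊤ : ℕ∞) (uncurry3 (_root_.dx w))
  rw [hw.uncurry3_dx]
  exact hw.contDiff_fderiv.clm_apply contDiff_const

lemma Smooth3.dy {w : ℝ → ℝ → ℝ → ℝ} (hw : Smooth3 w) : Smooth3 (dy w) := by
  change ContDiff ℝ (⊤ : ℕ∞) (uncurry3 (_root_.dy w))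
  rw [hw.uncurry3_dy]
  exact hw.contDiff_fderiv.clm_apply contDiff_const

lemma Smooth3.dt {w : ℝ → ℝ → ℝ → ℝ} (hw : Smooth3 w) : Smooth3 (dt w) := by
  change ContDiff ℝ (⊤ : ℕ∞) (uncurry3 (_root_.dt w))
  rw [hw.uncurry3_dt]
  exact hw.contDiff_fderiv.clm_apply contDiff_const

lemma Smooth3.hasDerivAt_dx {w : ℝ → ℝ → ℝ → ℝ} (hw : Smooth3 w) (x y t : ℝ) :
    HasDerivAt (fun s => w s y t) (_root_.dx w x y t) x :=
  (hw.hasDerivAt_fst_fderiv x y t).differentiableAt.hasDerivAt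

lemma Smooth3.hasDerivAt_dy {w : ℝ → ℝ → ℝ → ℝ} (hw : Smooth3 w) (x y t : ℝ) :
    HasDerivAt (fun s => w x s t) (_root_.dy w x y t) y :=
  (hw.hasDerivAt_snd_fderiv x y t).differentiableAt.hasDerivAt

lemma Smooth3.hasDerivAt_dt {w : ℝ → ℝ → ℝ → ℝ} (hw : Smooth3 w) (x y t : ℝ) :
    HasDerivAt (fun s => w x y s) (_root_.dt w x y t) t :=
  (hw.hasDerivAt_thd_fderiv x y t).differentiableAt.hasDerivAt

lemma Smooth3.fderiv_fderiv_comm {w : ℝ → ℝ → ℝ → ℝ} (hw : Smooth3 w) (p u v : ℝ × ℝ × ℝ) :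
    fderiv ℝ (fun q => fderiv ℝ (uncurry3 w) q u) p v
      = fderiv ℝ (fun q => fderiv ℝ (uncurry3 w) q v) p u := by
  have hd : DifferentiableAt ℝ (fderiv ℝ (uncurry3 w)) p :=
    hw.contDiff_fderiv.differentiable (by simp) p
  have hs : IsSymmSndFDerivAt ℝ (uncurry3 w) p :=
    (ContDiff.contDiffAt (f := uncurry3 w) hw).isSymmSndFDerivAt
      (by simpa using WithTop.coe_le_coe.2 (le_top : (2 : ℕ∞) ≤ ⊤))
  simpa [fderiv_clm_apply hd (differentiableAt_const _)] using hs v u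

lemma Smooth3.dx_dt_comm {w : ℝ → ℝ → ℝ → ℝ} (hw : Smooth3 w) :
    _root_.dx (_root_.dt w) = _root_.dt (_root_.dx w) := by
  funext x y t
  rw [(hw.dt.hasDerivAt_dx x y t).unique (hw.dt.hasDerivAt_fst_fderiv x y t),
    (hw.dx.hasDerivAt_dt x y t).unique (hw.dx.hasDerivAt_thd_fderiv x y t),
    hw.uncurry3_dt, hw.uncurry3_dx, hw.fderiv_fderiv_comm]

lemma Smooth3.dx_dy_comm {w : ℝ → ℝ → ℝ → ℝ} (hw : Smooth3 w) :
    _root_.dx (_root_.dy w) = _root_.dy (_root_.dx w) := by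
  funext x y t
  rw [(hw.dy.hasDerivAt_dx x y t).unique (hw.dy.hasDerivAt_fst_fderiv x y t),
    (hw.dx.hasDerivAt_dy x y t).unique (hw.dx.hasDerivAt_snd_fderiv x y t),
    hw.uncurry3_dy, hw.uncurry3_dx, hw.fderiv_fderiv_comm]

/-- A solution of PKP satisfies the `x`-derivative of the equation, which says that `dx w` is a
symmetry characteristic. -/
lemma PKP.linPKP_dx {w : ℝ → ℝ → ℝ → ℝ} (hsol : PKP w) (hw : Smooth3 w) : LinPKP w (dx w) := by
  intro x y t
  have key : HasDerivAt (fun s => dx (dt w) s y t) _ x :=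
    (((hw.dx.dx.dx.dx.hasDerivAt_dx x y t).const_mul (1/4)).add
      (((hw.dx.hasDerivAt_dx x y t).const_mul (3/2)).mul (hw.dx.dx.hasDerivAt_dx x y t))).add
      ((hw.dy.dy.hasDerivAt_dx x y t).const_mul (3/4))
      |>.congr_of_eventuallyEq (Filter.Eventually.of_forall fun s => hsol s y t)
  have e := (hw.dt.dx.hasDerivAt_dx x y t).unique key
  rw [hw.dy.dx_dy_comm, hw.dx_dy_comm] at e
  rw [← hw.dx_dt_comm, e]
  ring

/-- The Kac–Moody flow `X(h)` is a symmetry of PKP. -/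
theorem stmt4 (w : ℝ → ℝ → ℝ → ℝ) (hw : Smooth3 w) (hsol : PKP w)
    (h : ℝ → ℝ) (hh : ContDiff ℝ (⊤ : ℕ∞) h) :
    LinPKP w (fun x y t =>
      h t * dx w x y t
      + (2/3) * x * deriv h t
      + (4/9) * y ^ 2 * deriv (deriv h) t) := by
  have h0 : ∀ t, HasDerivAt h (deriv h t) t := fun t =>
    (hh.differentiable (by simp) t).hasDerivAt
  have hh1 : ContDiff ℝ (⊤ : ℕ∞) (deriv h) := (contDiff_infty_iff_deriv.1 hh).2
  have h1 : ∀ t, HasDerivAt (deriv h) (deriv (deriv h) t) t := fun t =>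
    (hh1.differentiable (by simp) t).hasDerivAt
  have hh2 : ContDiff ℝ (⊤ : ℕ∞) (deriv (deriv h)) := (contDiff_infty_iff_deriv.1 hh1).2
  have h2 : ∀ t, HasDerivAt (deriv (deriv h)) (deriv (deriv (deriv h)) t) t := fun t =>
    (hh2.differentiable (by simp) t).hasDerivAt
  set Q : ℝ → ℝ → ℝ → ℝ := fun x y t =>
    h t * dx w x y t + (2/3) * x * deriv h t + (4/9) * y ^ 2 * deriv (deriv h) t with hQ
  have Qx : dx Q = fun x y t => h t * dx (dx w) x y t + (2/3) * deriv h t := by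
    funext x y t
    refine HasDerivAt.deriv ?_
    have := (((hw.dx.hasDerivAt_dx x y t).const_mul (h t)).add
      (((hasDerivAt_id x).const_mul (2/3)).mul_const (deriv h t))).add_const
      ((4/9) * y ^ 2 * deriv (deriv h) t)
    exact this.congr_deriv (by ring)
  have Qxx : dx (dx Q) = fun x y t => h t * dx (dx (dx w)) x y t := by
    rw [Qx]
    funext x y t
    exact (((hw.dx.dx.hasDerivAt_dx x y t).const_mul (h t)).add_const _).deriv
  have Qxxx : dx (dx (dx Q)) = fun x y t => h t * dx (dx (dx (dx w))) x y t := by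
    rw [Qxx]
    funext x y t
    exact ((hw.dx.dx.dx.hasDerivAt_dx x y t).const_mul (h t)).deriv
  have Qxxxx : dx (dx (dx (dx Q))) = fun x y t => h t * dx (dx (dx (dx (dx w)))) x y t := by
    rw [Qxxx]
    funext x y t
    exact ((hw.dx.dx.dx.dx.hasDerivAt_dx x y t).const_mul (h t)).deriv
  have Qy : dy Q = fun x y t => h t * dy (dx w) x y t + (8/9) * y * deriv (deriv h) t := by
    funext x y t
    refine HasDerivAt.deriv ?_
    have := (((hw.dx.hasDerivAt_dy x y t).const_mul (h t)).add_const
      ((2/3) * x * deriv h t)).add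
      (((hasDerivAt_pow 2 y).const_mul (4/9)).mul_const (deriv (deriv h) t))
    exact this.congr_deriv (by push_cast; ring)
  have Qyy : dy (dy Q) = fun x y t => h t * dy (dy (dx w)) x y t + (8/9) * deriv (deriv h) t := by
    rw [Qy]
    funext x y t
    refine HasDerivAt.deriv ?_
    have := ((hw.dx.dy.hasDerivAt_dy x y t).const_mul (h t)).add
      (((hasDerivAt_id y).const_mul (8/9)).mul_const (deriv (deriv h) t))
    exact this.congr_deriv (by ring)
  have Qt : dt Q = fun x y t => deriv h t * dx w x y t + h t * dt (dx w) x y t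
      + (2/3) * x * deriv (deriv h) t + (4/9) * y ^ 2 * deriv (deriv (deriv h)) t := by
    funext x y t
    exact ((((h0 t).mul (hw.dx.hasDerivAt_dt x y t)).add ((h1 t).const_mul ((2/3) * x))).add
      ((h2 t).const_mul ((4/9) * y ^ 2))).deriv
  have Qtx : dx (dt Q) = fun x y t => deriv h t * dx (dx w) x y t + h t * dx (dt (dx w)) x y t
      + (2/3) * deriv (deriv h) t := by
    rw [Qt]
    funext x y t
    refine HasDerivAt.deriv ?_
    have := ((((hw.dx.hasDerivAt_dx x y t).const_mul (deriv h t)).add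
      ((hw.dx.dt.hasDerivAt_dx x y t).const_mul (h t))).add
      (((hasDerivAt_id x).const_mul (2/3)).mul_const (deriv (deriv h) t))).add_const
      ((4/9) * y ^ 2 * deriv (deriv (deriv h)) t)
    exact this.congr_deriv (by ring)
  intro x y t
  rw [Qtx, Qxxxx, Qxx, Qx, Qyy]
  linear_combination h t * hsol.linPKP_dx hw x y t
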